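/- arXiv:1005.2033 — 2 statements merged into one kernel-verified Lean document; each statement's English description precedes it below -/
import Mathlib

section
/- Let a ∈ (0, 1/2) be an irrational real number, and let P denote the normalized arc-length (Haar probability) measure on the unit circle S¹. Suppose (u_j) is a sequence of points of S¹ such that for every closed arc C of S¹ of arc length 2πa one has lim_{N→∞} (1/N) · #{ j ≤ N : u_j ∈ C } = a. Then (u_j) is uniformly distributed on S¹, that is, for every Borel set A ⊆ S¹ with P(∂A) = 0 one has lim_{N→∞} (1/N) · #{ j ≤ N : u_j ∈ A } = P(A). -/
open MeasureTheory Filter Real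

open scoped Classical in
/-- Relative frequency of hits of the first `N` terms of the sequence `u` in the set `A`. -/
noncomputable def freq {α : Type*} (u : ℕ → α) (A : Set α) (N : ℕ) : ℝ :=
  ((Finset.range N).filter (fun j => u j ∈ A)).card / N

instance : Fact (0 < 2 * π) := ⟨by positivity⟩

/-- The closed arc of the circle `ℝ / 2πℤ` starting at angle `β` of arc length `2πa`. -/
noncomputable def arc (a β : ℝ) : Set (AddCircle (2 * π)) :=
  (fun θ : ℝ => (θ : AddCircle (2 * π))) '' Set.Icc β (β + 2 * π * a)

/-- The empirical measure of the first `N + 1` terms of the sequence `u`. -/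
noncomputable def empiricalMeasure {α : Type*} [MeasurableSpace α] (u : ℕ → α) (N : ℕ) :
    Measure α :=
  ((N + 1 : ℕ) : ENNReal)⁻¹ • ∑ j ∈ Finset.range (N + 1), Measure.dirac (u j)

instance {α : Type*} [MeasurableSpace α] (u : ℕ → α) (N : ℕ) :
    IsProbabilityMeasure (empiricalMeasure u N) := by
  refine ⟨?_⟩
  simp only [empiricalMeasure, Measure.smul_apply, Measure.finsetSum_apply, measure_univ,
    Finset.sum_const, Finset.card_range, smul_eq_mul, nsmul_eq_mul, mul_one]
  exact ENNReal.inv_mul_cancel (by simp) (ENNReal.natCast_ne_top _)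

theorem integral_empiricalMeasure {α : Type*} [MeasurableSpace α] [MeasurableSingletonClass α]
    (u : ℕ → α) (N : ℕ) (f : α → ℂ) :
    ∫ x, f x ∂(empiricalMeasure u N) =
      ((N + 1 : ℕ) : ℂ)⁻¹ * ∑ j ∈ Finset.range (N + 1), f (u j) := by
  rw [empiricalMeasure, integral_smul_measure, integral_finsetSum_measure]
  · simp only [integral_dirac, ENNReal.toReal_inv, ENNReal.toReal_natCast, Complex.real_smul,
      Complex.ofReal_inv, Complex.ofReal_natCast]
  · intro j _
    exact integrable_dirac (by simp)

theorem freq_eq_sum_indicator {α : Type*} (u : ℕ → α) (A : Set α) (N : ℕ) :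
    freq u A N = (N : ℝ)⁻¹ * ∑ j ∈ Finset.range N, A.indicator 1 (u j) := by
  classical
  simp only [freq, Finset.card_filter, Set.indicator_apply]
  push_cast
  rw [div_eq_inv_mul]
  simp

theorem freq_le_one {α : Type*} (u : ℕ → α) (A : Set α) (N : ℕ) : freq u A N ≤ 1 := by
  classical
  refine div_le_one_of_le₀ ?_ (by positivity)
  exact_mod_cast (Finset.card_filter_le _ _).trans (Finset.card_range N).le

theorem toReal_empiricalMeasure {α : Type*} [MeasurableSpace α] (u : ℕ → α) (N : ℕ)
    {A : Set α} (hA : MeasurableSet A) :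
    (empiricalMeasure u N A).toReal = freq u A (N + 1) := by
  classical
  rw [freq_eq_sum_indicator]
  simp only [empiricalMeasure, Measure.smul_apply, Measure.finsetSum_apply, smul_eq_mul,
    Measure.dirac_apply' _ hA, ENNReal.toReal_mul, ENNReal.toReal_inv, ENNReal.toReal_natCast]
  rw [ENNReal.toReal_sum]
  · congr 1
    refine Finset.sum_congr rfl fun j _ => ?_
    by_cases h : u j ∈ A <;> simp [h]
  · intro j _
    by_cases h : u j ∈ A <;> simp [h]

theorem mem_arc_iff (a β : ℝ) (y : AddCircle (2 * π)) :
    y ∈ arc a β ↔ y - (β : AddCircle (2 * π)) ∈ arc a 0 := by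
  constructor
  · rintro ⟨θ, ⟨h₁, h₂⟩, rfl⟩
    exact ⟨θ - β, ⟨by linarith, by linarith⟩, by simp⟩
  · rintro ⟨θ, ⟨h₁, h₂⟩, h⟩
    refine ⟨θ + β, ⟨by linarith, by linarith⟩, ?_⟩
    simp only at h
    simp [h]

theorem measurableSet_arc (a β : ℝ) : MeasurableSet (arc a β) :=
  (isCompact_Icc.image (AddCircle.continuous_mk' (2 * π))).isClosed.measurableSet

/-- Inside one period ending at the right endpoint, the closed arc is an interval. -/
theorem coe_mem_arc_zero_iff {a x : ℝ} (hx : x ∈ Set.Ioc (2 * π * a - 2 * π) (2 * π * a)) :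
    (x : AddCircle (2 * π)) ∈ arc a 0 ↔ 0 ≤ x := by
  constructor
  · rintro ⟨θ, ⟨h₁, h₂⟩, h⟩
    by_contra! hlt
    have hx2 : x + 2 * π ∈ Set.Ioc (2 * π * a) (2 * π * a + 2 * π) :=
      ⟨by linarith [hx.1], by linarith [Real.pi_pos]⟩
    obtain ⟨k, hk⟩ := (AddCircle.coe_eq_zero_iff (p := 2 * π) (x := θ - x)).1 (by
      simp only at h
      simp [h])
    rw [zsmul_eq_mul] at hk
    have hpi := Real.pi_pos
    have hk0 : (0 : ℝ) < k := by
      by_contra! hk'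
      nlinarith
    have hk1 : (1 : ℝ) ≤ k := by
      have : (0 : ℤ) < k := by exact_mod_cast hk0
      exact_mod_cast this
    nlinarith [hx.1]
  · intro h
    exact ⟨x, ⟨h, by linarith [hx.2]⟩, rfl⟩

theorem fourierCoeff_indicator_arc {a : ℝ} (ha : a ∈ Set.Ioo (0 : ℝ) 1) {n : ℤ} (hn : n ≠ 0) :
    fourierCoeff ((arc a 0).indicator (1 : AddCircle (2 * π) → ℂ)) n =
      (1 / (2 * π)) • ((Complex.exp (-(n * (2 * π * a)) * Complex.I) - 1) / (-n * Complex.I)) := by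
  have hpi := Real.pi_pos
  have hpos : 0 < 2 * π * a := mul_pos (by positivity) ha.1
  have hlt : 2 * π * a - 2 * π < 0 := by nlinarith [ha.2]
  have hc : (-n * Complex.I : ℂ) ≠ 0 := by simp [hn]
  rw [fourierCoeff_eq_intervalIntegral _ _ (2 * π * a - 2 * π), sub_add_cancel]
  congr 1
  have key : ∫ x in (2 * π * a - 2 * π)..(2 * π * a), fourier (-n) (x : AddCircle (2 * π)) •
        (arc a 0).indicator (1 : AddCircle (2 * π) → ℂ) x =
      ∫ x in (0 : ℝ)..(2 * π * a), Complex.exp ((-n * Complex.I) * x) := by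
    rw [intervalIntegral.integral_of_le (by linarith), intervalIntegral.integral_of_le hpos.le,
      ← integral_Icc_eq_integral_Ioc (x := (0 : ℝ)),
      ← integral_indicator measurableSet_Ioc, ← integral_indicator measurableSet_Icc]
    congr 1
    ext x
    by_cases hx : x ∈ Set.Ioc (2 * π * a - 2 * π) (2 * π * a)
    · rw [Set.indicator_of_mem hx]
      by_cases h0 : 0 ≤ x
      · rw [Set.indicator_of_mem ((coe_mem_arc_zero_iff hx).2 h0),
          Set.indicator_of_mem (Set.mem_Icc.2 ⟨h0, hx.2⟩), fourier_coe_apply]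
        have : (π : ℂ) ≠ 0 := by exact_mod_cast hpi.ne'
        simp only [Pi.one_apply, smul_eq_mul, mul_one]
        congr 1
        push_cast
        field_simp
      · rw [Set.indicator_of_notMem (fun h => h0 ((coe_mem_arc_zero_iff hx).1 h)),
          Set.indicator_of_notMem (fun h : x ∈ Set.Icc 0 (2 * π * a) => h0 h.1), smul_zero]
    · rw [Set.indicator_of_notMem hx, Set.indicator_of_notMem]
      exact fun h => hx ⟨hlt.trans_le h.1, h.2⟩
  rw [key, integral_exp_mul_complex hc]
  simp only [Complex.ofReal_zero, mul_zero, Complex.exp_zero]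
  congr 3
  push_cast
  ring

theorem fourierCoeff_indicator_arc_ne_zero {a : ℝ} (ha : a ∈ Set.Ioo (0 : ℝ) 1)
    (hirr : Irrational a) {n : ℤ} (hn : n ≠ 0) :
    fourierCoeff ((arc a 0).indicator (1 : AddCircle (2 * π) → ℂ)) n ≠ 0 := by
  rw [fourierCoeff_indicator_arc ha hn]
  have hpi : (π : ℂ) ≠ 0 := by exact_mod_cast Real.pi_ne_zero
  refine smul_ne_zero (by positivity) (div_ne_zero (fun h => ?_) (by simp [hn]))
  obtain ⟨k, hk⟩ := Complex.exp_eq_one_iff.1 (sub_eq_zero.1 h)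
  have h2 : (2 * π * Complex.I : ℂ) * (-(n * a)) = (2 * π * Complex.I) * k := by
    linear_combination hk
  have h3 := mul_left_cancel₀ (by simp [hpi]) h2
  have h4 : -((n : ℝ) * a) = k := by exact_mod_cast h3
  exact (hirr.intCast_mul hn).neg.ne_int k h4

theorem integral_sub_left_mul_fourier {T : ℝ} [Fact (0 < T)] (f : AddCircle T → ℂ) (n : ℤ)
    (y : AddCircle T) :
    ∫ x, f (y - x) * fourier n x ∂AddCircle.haarAddCircle = fourier n y * fourierCoeff f n := by
  rw [fourierCoeff, ← integral_const_mul,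
    ← integral_sub_left_eq_self (fun t => fourier n y * (fourier (-n) t • f t)) _ y]
  congr 1
  ext x
  have h : (fourier n x : ℂ) = fourier n y * fourier (-n) (y - x) := by
    simp only [fourier_apply, ← Circle.coe_mul, ← AddCircle.toCircle_add]
    congr 2
    simp [smul_sub]
  rw [h, smul_eq_mul]
  ring

theorem integral_fourier_haarAddCircle {T : ℝ} [Fact (0 < T)] {n : ℤ} (hn : n ≠ 0) :
    ∫ x : AddCircle T, fourier n x ∂AddCircle.haarAddCircle = 0 :=
  integral_eq_zero_of_add_right_eq_neg (fourier_add_half_inv_index hn Fact.out)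

/-- If all translates of a measurable set `K` have an asymptotic frequency `c` along `u`, then the
Weyl sums of `u` vanish asymptotically at the frequencies where the Fourier coefficient of `K`
does not vanish. -/
theorem tendsto_integral_fourier_empiricalMeasure {T : ℝ} [Fact (0 < T)] {u : ℕ → AddCircle T}
    {K : Set (AddCircle T)} (hK : MeasurableSet K) {c : ℝ}
    (H : ∀ x, Tendsto (fun N => freq u {y | y - x ∈ K} N) atTop (nhds c)) {n : ℤ} (hn : n ≠ 0)
    (hKn : fourierCoeff (K.indicator (1 : AddCircle T → ℂ)) n ≠ 0) :
    Tendsto (fun N => ∫ x, fourier n x ∂(empiricalMeasure u N)) atTop (nhds 0) := by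
  have hfreq (N : ℕ) (x : AddCircle T) : (freq u {y | y - x ∈ K} N : ℂ) * fourier n x =
      (N : ℂ)⁻¹ * ∑ j ∈ Finset.range N,
        K.indicator (1 : AddCircle T → ℂ) (u j - x) * fourier n x := by
    rw [freq_eq_sum_indicator, ← Finset.sum_mul, ← mul_assoc]
    push_cast
    congr 2
    refine Finset.sum_congr rfl fun j _ => ?_
    by_cases h : u j - x ∈ K <;> simp [h]
  have hmeas (y : AddCircle T) :
      Measurable fun x => K.indicator (1 : AddCircle T → ℂ) (y - x) * fourier n x :=
    ((measurable_one.indicator hK).comp (measurable_const.sub measurable_id)).mul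
      (fourier n).continuous.measurable
  have hbound (y x : AddCircle T) :
      ‖K.indicator (1 : AddCircle T → ℂ) (y - x) * fourier n x‖ ≤ 1 := by
    rw [norm_mul, fourier_apply, Circle.norm_coe, mul_one]
    by_cases h : y - x ∈ K <;> simp [h]
  have hint (N : ℕ) : ∫ x, (freq u {y | y - x ∈ K} (N + 1) : ℂ) * fourier n x
        ∂AddCircle.haarAddCircle =
      (∫ x, fourier n x ∂(empiricalMeasure u N)) *
        fourierCoeff (K.indicator (1 : AddCircle T → ℂ)) n := by
    simp_rw [hfreq]
    rw [integral_const_mul, integral_finsetSum, integral_empiricalMeasure, mul_assoc,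
      Finset.sum_mul]
    · simp_rw [integral_sub_left_mul_fourier]
    · intro j _
      exact Integrable.of_bound (hmeas _).aestronglyMeasurable 1 (ae_of_all _ (hbound _))
  have hlim : Tendsto (fun N => ∫ x, (freq u {y | y - x ∈ K} (N + 1) : ℂ) * fourier n x
      ∂AddCircle.haarAddCircle) atTop
      (nhds (∫ x : AddCircle T, (c : ℂ) * fourier n x ∂AddCircle.haarAddCircle)) := by
    refine tendsto_integral_of_dominated_convergence (fun _ => 1) (fun N => ?_)
      (integrable_const 1) (fun N => ae_of_all _ fun x => ?_) (ae_of_all _ fun x => ?_)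
    · simp_rw [hfreq]
      exact ((Finset.measurable_fun_sum _ fun j _ => hmeas (u j)).const_mul _).aestronglyMeasurable
    · rw [norm_mul, fourier_apply, Circle.norm_coe, mul_one, Complex.norm_real,
        Real.norm_of_nonneg (by unfold freq; positivity)]
      exact freq_le_one _ _ _
    · exact ((Complex.continuous_ofReal.tendsto c).comp
        ((H x).comp (tendsto_add_atTop_nat 1))).mul_const _
  rw [integral_const_mul, integral_fourier_haarAddCircle hn, mul_zero] at hlim
  simp_rw [hint] at hlim
  simpa [hKn] using hlim.div_const (fourierCoeff (K.indicator (1 : AddCircle T → ℂ)) n)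

/-- Probability measures on the circle converge weakly to the Haar measure if their Fourier
coefficients of nonzero index tend to zero. -/
theorem tendsto_haarAddCircle_of_tendsto_fourier {T : ℝ} [Fact (0 < T)]
    {μ : ℕ → ProbabilityMeasure (AddCircle T)}
    (h : ∀ n : ℤ, n ≠ 0 →
      Tendsto (fun N => ∫ x, fourier n x ∂(μ N : Measure (AddCircle T))) atTop (nhds 0)) :
    Tendsto μ atTop
      (nhds (⟨AddCircle.haarAddCircle, inferInstance⟩ : ProbabilityMeasure (AddCircle T))) := by
  refine (ProbabilityMeasure.tendsto_iff_forall_integral_rclike_tendsto ℂ).2 ?_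
  have hi (ν : Measure (AddCircle T)) [IsProbabilityMeasure ν] (f : C(AddCircle T, ℂ)) :
      Integrable f ν :=
    Integrable.of_bound f.continuous.measurable.aestronglyMeasurable ‖f‖
      (ae_of_all _ f.norm_coe_le_norm)
  have hlip (ν : Measure (AddCircle T)) [IsProbabilityMeasure ν] :
      LipschitzWith 1 fun f : C(AddCircle T, ℂ) => ∫ x, f x ∂ν := by
    refine LipschitzWith.of_dist_le_mul fun f g => ?_
    rw [dist_eq_norm, ← integral_sub (hi ν f) (hi ν g), dist_eq_norm]
    simpa using norm_integral_le_of_norm_le_const (μ := ν)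
      (ae_of_all _ (f - g).norm_coe_le_norm)
  let S : Submodule ℂ C(AddCircle T, ℂ) :=
    { carrier := {f | Tendsto (fun N => ∫ x, f x ∂(μ N : Measure (AddCircle T))) atTop
        (nhds (∫ x, f x ∂AddCircle.haarAddCircle))}
      add_mem' := by
        intro f g hf hg
        simp only [Set.mem_ofPred_eq, ContinuousMap.add_apply] at hf hg ⊢
        simp_rw [fun ν [IsProbabilityMeasure ν] => integral_add (hi ν f) (hi ν g)]
        exact hf.add hg
      zero_mem' := by simp
      smul_mem' := by
        intro c f hf
        simp only [Set.mem_ofPred_eq, ContinuousMap.smul_apply, integral_smul] at hf ⊢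
        exact hf.const_smul c }
  have hclosed : IsClosed (S : Set C(AddCircle T, ℂ)) :=
    (LipschitzWith.uniformEquicontinuous _ 1
      fun N => hlip (μ N : Measure (AddCircle T))).equicontinuous.isClosed_setOfPred_tendsto
      (hlip AddCircle.haarAddCircle).continuous
  have hspan : Submodule.span ℂ (Set.range (@fourier T)) ≤ S := by
    rw [Submodule.span_le]
    rintro _ ⟨n, rfl⟩
    change Tendsto _ _ _
    rcases eq_or_ne n 0 with rfl | hn
    · simp
    · rw [integral_fourier_haarAddCircle hn]
      exact h n hn
  have htop : S = ⊤ := top_le_iff.1 <|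
    span_fourier_closure_eq_top.ge.trans (Submodule.topologicalClosure_minimal _ hspan hclosed)
  intro f
  exact (htop ▸ Submodule.mem_top : f.toContinuousMap ∈ S)

theorem stmt0 (a : ℝ) (ha : a ∈ Set.Ioo (0 : ℝ) (1 / 2)) (hirr : Irrational a)
    (u : ℕ → AddCircle (2 * π))
    (H : ∀ β : ℝ, Tendsto (fun N => freq u (arc a β) N) atTop (nhds a)) :
    ∀ A : Set (AddCircle (2 * π)), MeasurableSet A →
      (AddCircle.haarAddCircle : Measure (AddCircle (2 * π))) (frontier A) = 0 →
      Tendsto (fun N => freq u A N) atTop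
        (nhds ((AddCircle.haarAddCircle : Measure (AddCircle (2 * π))) A).toReal) := by
  intro A hA hA0
  have hweak := tendsto_haarAddCircle_of_tendsto_fourier
    (μ := fun N => ⟨empiricalMeasure u N, inferInstance⟩) fun n hn =>
      tendsto_integral_fourier_empiricalMeasure (measurableSet_arc a 0) (c := a) (fun x => by
        induction x using QuotientAddGroup.induction_on with
        | H β =>
          have harc : {y | y - (β : AddCircle (2 * π)) ∈ arc a 0} = arc a β :=
            Set.ext fun y => (mem_arc_iff a β y).symm
          exact harc ▸ H β) hn
        (fourierCoeff_indicator_arc_ne_zero ⟨ha.1, ha.2.trans (by norm_num)⟩ hirr hn)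
  have hlim := (ENNReal.tendsto_toReal (measure_ne_top AddCircle.haarAddCircle A)).comp
    (ProbabilityMeasure.tendsto_measure_of_null_frontier_of_tendsto' hweak hA0)
  refine (tendsto_add_atTop_iff_nat 1).1 (hlim.congr fun N => ?_)
  exact toReal_empiricalMeasure u N hA
end

section
/- Let a ∈ (0, 1/2) be a rational number. Then there exists a sequence (v_j) of points of the unit circle S¹ such that for every closed arc C of S¹ of arc length 2πa one has lim_{N→∞} (1/N) · #{ j ≤ N : v_j ∈ C } = a, and yet (v_j) is not uniformly distributed on S¹: there exists a Borel set A ⊆ S¹ with P(∂A) = 0 such that (1/N) · #{ j ≤ N : v_j ∈ A } does not converge to P(A), where P is the normalized arc-length measure. -/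
open MeasureTheory Filter Real

theorem card_filter_range_exists_int_mem_Icc {p q : ℕ} (hpq : p ≤ q) (hq : 0 < q) {t : ℝ}
    (ht : ∀ m : ℤ, (m : ℝ) ≠ t)
    [DecidablePred fun k : ℕ => ∃ n : ℤ, t ≤ k + n * q ∧ k + n * q ≤ t + p] :
    ((Finset.range q).filter
      (fun k : ℕ => ∃ n : ℤ, t ≤ k + n * q ∧ k + n * q ≤ t + p)).card = p := by
  have hq' : (0 : ℤ) < q := by exact_mod_cast hq
  have key : (Finset.range q).filter
      (fun k : ℕ => ∃ n : ℤ, t ≤ k + n * q ∧ k + n * q ≤ t + p) =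
      (Finset.Ico ⌈t⌉ (⌈t⌉ + p)).image (fun m : ℤ => (m % q).toNat) := by
    ext k
    simp only [Finset.mem_filter, Finset.mem_range, Finset.mem_image, Finset.mem_Ico]
    constructor
    · rintro ⟨hk, n, h1, h2⟩
      refine ⟨k + n * q, ⟨Int.ceil_le.2 (by push_cast; exact h1), ?_⟩, ?_⟩
      · have h3 : (((k + n * q - p : ℤ)) : ℝ) < t :=
          lt_of_le_of_ne (by push_cast; linarith) (ht _)
        have := Int.lt_ceil.2 h3
        omega
      · rw [Int.add_mul_emod_self_right, Int.emod_eq_of_lt (by omega) (by omega)]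
        simp
    · rintro ⟨m, ⟨h1, h2⟩, rfl⟩
      have h3 := Int.emod_nonneg m hq'.ne'
      have h4 := Int.emod_lt_of_pos m hq'
      have h5 : ((m % q).toNat : ℤ) + m / q * q = m := by
        rw [Int.toNat_of_nonneg h3, mul_comm]
        exact Int.emod_add_mul_ediv m q
      have h6 : ((m % q).toNat : ℝ) + (m / q : ℤ) * q = m := by exact_mod_cast h5
      refine ⟨by omega, m / q, ?_⟩
      rw [h6]
      have h7 : ((m - p : ℤ) : ℝ) < t := Int.lt_ceil.1 (by omega)
      push_cast at h7
      exact ⟨Int.ceil_le.1 h1, by linarith⟩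
  rw [key, Finset.card_image_of_injOn]
  · simp
  · intro m hm n hn h
    simp only [Finset.coe_Ico, Set.mem_Ico] at hm hn
    have h1 := Int.emod_nonneg m hq'.ne'
    have h2 := Int.emod_nonneg n hq'.ne'
    have h3 : m % q = n % q := by
      have h' : (m % q).toNat = (n % q).toNat := h
      omega
    have h4 : (q : ℤ) ∣ m - n := Int.ModEq.dvd (show n ≡ m [ZMOD q] from h3.symm)
    have h5 := Int.eq_zero_of_abs_lt_dvd h4 (by rw [abs_lt]; constructor <;> omega)
    omega

theorem coe_mem_arc_iff (a β x : ℝ) :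
    (x : AddCircle (2 * π)) ∈ arc a β ↔
      ∃ n : ℤ, β ≤ x + n * (2 * π) ∧ x + n * (2 * π) ≤ β + 2 * π * a := by
  simp only [arc, Set.mem_image, Set.mem_Icc]
  constructor
  · rintro ⟨y, ⟨h1, h2⟩, h⟩
    obtain ⟨n, hn⟩ := (QuotientAddGroup.eq_iff_sub_mem.1 h : y - x ∈ _)
    simp only [zsmul_eq_mul] at hn
    exact ⟨n, by linarith, by linarith⟩
  · rintro ⟨n, h1, h2⟩
    refine ⟨x + n * (2 * π), ⟨h1, h2⟩, ?_⟩
    refine (QuotientAddGroup.eq_iff_sub_mem.2 ⟨n, ?_⟩)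
    simp

/-- Averages of a bounded sequence converge to `c` if its block sums of length `q` are eventually
equal to `q * c`. -/
theorem tendsto_sum_div_of_eventually_block_sum {q : ℕ} (hq : 0 < q) {f : ℕ → ℝ} {c : ℝ}
    (hf : ∀ j, |f j - c| ≤ 1) {M₀ : ℕ}
    (h : ∀ i, M₀ ≤ i → ∑ k ∈ Finset.range q, f (q * i + k) = q * c) :
    Tendsto (fun N : ℕ => (∑ j ∈ Finset.range N, f j) / N) atTop (nhds c) := by
  set F : ℕ → ℝ := fun N => ∑ j ∈ Finset.range N, (f j - c) with hF
  have hblock (g : ℕ → ℝ) (hg : ∀ j, |g j| ≤ 1) (n : ℕ) :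
      |∑ j ∈ Finset.range n, g j| ≤ n := by
    refine (Finset.abs_sum_le_sum_abs _ _).trans ?_
    simpa using Finset.sum_le_sum (s := Finset.range n) (fun j _ => hg j)
  have hstep : ∀ M, M₀ ≤ M → F (q * M) = F (q * M₀) := by
    intro M hM
    induction M, hM using Nat.le_induction with
    | base => rfl
    | succ i hi ih =>
      rw [← ih, mul_add, mul_one]
      simp only [hF]
      rw [Finset.sum_range_add, Finset.sum_sub_distrib (fun k => f (q * i + k)), h i hi]
      simp
  have hbound : ∀ N, q * M₀ ≤ N → |F N| ≤ q * M₀ + q := by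
    intro N hN
    have h1 : M₀ ≤ N / q := (Nat.le_div_iff_mul_le hq).2 (by rwa [mul_comm])
    have h2 : F N = F (q * M₀) + ∑ k ∈ Finset.range (N % q), (f (q * (N / q) + k) - c) := by
      rw [← hstep _ h1]
      conv_lhs => rw [← Nat.div_add_mod N q]
      exact Finset.sum_range_add _ _ _
    have h3 := hblock (fun j => f j - c) hf (q * M₀)
    have h4 := hblock (fun k => f (q * (N / q) + k) - c) (fun k => hf _) (N % q)
    have h5 : ((N % q : ℕ) : ℝ) ≤ q := by exact_mod_cast (Nat.mod_lt N hq).le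
    rw [h2]
    refine (abs_add_le _ _).trans ?_
    push_cast at h3
    exact add_le_add h3 (h4.trans h5)
  have hzero : Tendsto (fun N : ℕ => F N / N) atTop (nhds 0) := by
    refine squeeze_zero_norm' ?_
      (tendsto_const_div_atTop_nhds_zero_nat ((q : ℝ) * M₀ + q))
    filter_upwards [eventually_ge_atTop (q * M₀)] with N hN
    rw [Real.norm_eq_abs, abs_div, Nat.abs_cast]
    gcongr
    exact hbound N hN
  refine (by simpa using hzero.add_const c : Tendsto (fun N : ℕ => F N / N + c) atTop
    (nhds c)).congr' ?_
  filter_upwards [eventually_gt_atTop 0] with N hN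
  have : (N : ℝ) ≠ 0 := by exact_mod_cast hN.ne'
  simp only [hF, Finset.sum_sub_distrib, Finset.sum_const, Finset.card_range, nsmul_eq_mul]
  field_simp
  ring

theorem haarAddCircle_frontier_closedBall (x : AddCircle (2 * π)) (ε : ℝ) :
    (AddCircle.haarAddCircle : Measure (AddCircle (2 * π)))
      (frontier (Metric.closedBall x ε)) = 0 := by
  have h : (volume : Measure (AddCircle (2 * π))) (frontier (Metric.closedBall x ε)) = 0 := by
    refine measure_mono_null ?_ (ae_le_set.1 (AddCircle.closedBall_ae_eq_ball (x := x) (ε := ε)).le)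
    rw [frontier, Metric.isClosed_closedBall.closure_eq]
    exact Set.sdiff_subset_sdiff_right Metric.ball_subset_interior_closedBall
  rw [AddCircle.volume_eq_smul_haarAddCircle] at h
  simpa [Real.pi_pos.not_ge] using h

theorem haarAddCircle_closedBall (x : AddCircle (2 * π)) {ε : ℝ} (hε : 0 ≤ ε) (hε' : ε ≤ π) :
    ((AddCircle.haarAddCircle : Measure (AddCircle (2 * π))) (Metric.closedBall x ε)).toReal =
      ε / π := by
  have h := AddCircle.volume_closedBall (2 * π) (x := x) ε
  rw [AddCircle.volume_eq_smul_haarAddCircle, Measure.smul_apply, smul_eq_mul] at h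
  have h' := congrArg ENNReal.toReal h
  rw [ENNReal.toReal_mul, ENNReal.toReal_ofReal (by positivity), min_eq_right (by linarith),
    ENNReal.toReal_ofReal (by positivity)] at h'
  have := Real.pi_pos
  field_simp
  linarith

/-- The angles of a sequence running through translated regular `q`-gons, with pairwise distinct
offsets tending to `0`. -/
noncomputable def polygonAngle (q j : ℕ) : ℝ :=
  2 * π / q * (1 / (4 * ((j / q : ℕ) + 1)) + (j % q : ℕ))

theorem polygonAngle_mul_add {q k : ℕ} (hk : k < q) (i : ℕ) :
    polygonAngle q (q * i + k) = 2 * π / q * (1 / (4 * (i + 1)) + k) := by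
  rw [polygonAngle, Nat.mul_add_mod, Nat.mod_eq_of_lt hk, Nat.mul_add_div (by omega),
    Nat.div_eq_of_lt hk, add_zero]

theorem eventually_offset_ne_int (b : ℝ) :
    ∃ M₀ : ℕ, ∀ i : ℕ, M₀ ≤ i → ∀ m : ℤ, (m : ℝ) ≠ b - 1 / (4 * (i + 1)) := by
  have hu (i : ℕ) : 0 < 1 / (4 * ((i : ℝ) + 1)) ∧ 1 / (4 * ((i : ℝ) + 1)) < 1 := by
    refine ⟨by positivity, ?_⟩
    rw [div_lt_one (by positivity)]
    have : (0 : ℝ) ≤ i := i.cast_nonneg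
    linarith
  by_contra! hcon
  obtain ⟨i, -, m, hm⟩ := hcon 0
  obtain ⟨j, hj, n, hn⟩ := hcon (i + 1)
  have hi' := hu i
  have hj' := hu j
  have hmn : m = n := by
    have h1 : (m : ℝ) < n + 1 := by linarith
    have h2 : (n : ℝ) < m + 1 := by linarith
    have h3 : m < n + 1 := by exact_mod_cast h1
    have h4 : n < m + 1 := by exact_mod_cast h2
    omega
  rw [← hmn] at hn
  have hlt : (i : ℝ) < j := by exact_mod_cast hj
  have : 1 / (4 * ((j : ℝ) + 1)) < 1 / (4 * ((i : ℝ) + 1)) := by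
    gcongr
  linarith

open scoped Classical in
theorem tendsto_freq_arc_polygonAngle {p q : ℕ} (hpq : p ≤ q) (hq : 0 < q) (β : ℝ) :
    Tendsto (fun N => freq (fun j => (polygonAngle q j : AddCircle (2 * π)))
      (arc ((p : ℝ) / q) β) N) atTop (nhds ((p : ℝ) / q)) := by
  have hq' : (0 : ℝ) < q := by exact_mod_cast hq
  have hpq' : (p : ℝ) ≤ q := by exact_mod_cast hpq
  have hπ := Real.pi_pos
  obtain ⟨M₀, hM₀⟩ := eventually_offset_ne_int (β * q / (2 * π))
  have hmain := tendsto_sum_div_of_eventually_block_sum hq (c := (p : ℝ) / q) (M₀ := M₀)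
    (f := fun j => if (polygonAngle q j : AddCircle (2 * π)) ∈ arc ((p : ℝ) / q) β
      then 1 else 0) ?_ ?_
  · simpa [freq] using hmain
  · intro j
    have h0 : 0 ≤ (p : ℝ) / q := by positivity
    have h1 : (p : ℝ) / q ≤ 1 := (div_le_one hq').2 hpq'
    rw [abs_le]
    split_ifs <;> constructor <;> linarith
  · intro i hi
    rw [Finset.sum_boole, mul_div_cancel₀ _ hq'.ne']
    refine Eq.trans ?_ (congrArg Nat.cast
      (card_filter_range_exists_int_mem_Icc hpq hq (hM₀ i hi)))
    congr 2
    refine Finset.filter_congr fun k hk => ?_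
    rw [polygonAngle_mul_add (Finset.mem_range.1 hk), coe_mem_arc_iff]
    refine exists_congr fun n => ?_
    have e1 : 2 * π / q * (1 / (4 * ((i : ℝ) + 1)) + k) + n * (2 * π) =
        2 * π / q * (1 / (4 * ((i : ℝ) + 1)) + (k + n * q)) := by
      field_simp
      ring
    have e2 : β + 2 * π * ((p : ℝ) / q) = 2 * π / q * (β * q / (2 * π) + p) := by
      field_simp
    have e3 : β = 2 * π / q * (β * q / (2 * π)) := by field_simp
    have hc : 0 < 2 * π / q := by positivity
    refine and_congr ?_ ?_
    · conv_lhs => rw [e1, e3]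
      rw [mul_le_mul_iff_right₀ hc]
      constructor <;> intro <;> linarith
    · rw [e1, e2, mul_le_mul_iff_right₀ hc]
      constructor <;> intro <;> linarith

theorem polygonAngle_mul_mem_closedBall {q : ℕ} (hq : 0 < q) (i : ℕ) :
    (polygonAngle q (q * i) : AddCircle (2 * π)) ∈ Metric.closedBall 0 (π / (2 * q)) := by
  have hq' : (0 : ℝ) < q := by exact_mod_cast hq
  have hπ := Real.pi_pos
  have h := polygonAngle_mul_add hq i
  simp only [add_zero, Nat.cast_zero] at h
  rw [mem_closedBall_zero_iff]
  refine (QuotientAddGroup.norm_mk_le_norm).trans ?_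
  rw [h, Real.norm_eq_abs, abs_of_nonneg (by positivity)]
  have h1 : 1 / (4 * ((i : ℝ) + 1)) ≤ 1 / 4 := by
    gcongr
    have : (0 : ℝ) ≤ i := i.cast_nonneg
    linarith
  calc 2 * π / q * (1 / (4 * ((i : ℝ) + 1))) ≤ 2 * π / q * (1 / 4) := by gcongr
    _ = π / (2 * q) := by field_simp; norm_num

theorem one_div_le_freq_mul {α : Type*} {u : ℕ → α} {A : Set α} {q : ℕ} (hq : 0 < q)
    (h : ∀ i, u (q * i) ∈ A) {M : ℕ} (hM : 0 < M) : 1 / (q : ℝ) ≤ freq u A (q * M) := by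
  classical
  have hq' : (0 : ℝ) < q := by exact_mod_cast hq
  have hM' : (0 : ℝ) < M := by exact_mod_cast hM
  have hcard : M ≤ ((Finset.range (q * M)).filter (fun j => u j ∈ A)).card := by
    have hinj : Function.Injective (fun i => q * i) := fun i j hij =>
      Nat.eq_of_mul_eq_mul_left hq hij
    calc M = ((Finset.range M).image (fun i => q * i)).card := by
          rw [Finset.card_image_of_injective _ hinj, Finset.card_range]
      _ ≤ _ := Finset.card_le_card fun j hj => by
          obtain ⟨i, hi, rfl⟩ := Finset.mem_image.1 hj
          exact Finset.mem_filter.2 ⟨Finset.mem_range.2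
            (Nat.mul_lt_mul_of_pos_left (Finset.mem_range.1 hi) hq), h i⟩
  have hcard' : (M : ℝ) ≤ (((Finset.range (q * M)).filter (fun j => u j ∈ A)).card : ℝ) := by
    exact_mod_cast hcard
  calc 1 / (q : ℝ) = M / ((q * M : ℕ) : ℝ) := by push_cast; field_simp
    _ ≤ freq u A (q * M) := by
        unfold freq
        gcongr

theorem stmt1 (a : ℚ) (ha : (a : ℝ) ∈ Set.Ioo (0 : ℝ) (1 / 2)) :
    ∃ v : ℕ → AddCircle (2 * π),
      (∀ β : ℝ, Tendsto (fun N => freq v (arc (a : ℝ) β) N) atTop (nhds (a : ℝ))) ∧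
      ∃ A : Set (AddCircle (2 * π)), MeasurableSet A ∧
        (AddCircle.haarAddCircle : Measure (AddCircle (2 * π))) (frontier A) = 0 ∧
        ¬ Tendsto (fun N => freq v A N) atTop
          (nhds ((AddCircle.haarAddCircle : Measure (AddCircle (2 * π))) A).toReal) := by
  obtain ⟨ha0, ha1⟩ := ha
  have hq : 0 < a.den := a.pos
  have hq' : (0 : ℝ) < a.den := by exact_mod_cast hq
  have hπ := Real.pi_pos
  have ha0' : 0 < a := by exact_mod_cast ha0
  have hnum : ((a.num.toNat : ℕ) : ℤ) = a.num :=
    Int.toNat_of_nonneg (Rat.num_nonneg.2 ha0'.le)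
  have hcast : (a : ℝ) = (a.num.toNat : ℝ) / a.den := by
    rw [Rat.cast_def, ← Int.cast_natCast (a.num.toNat), hnum]
  have hle : a.num.toNat ≤ a.den := by
    have h1 : (a.num.toNat : ℝ) / a.den ≤ 1 := by linarith
    rw [div_le_one hq'] at h1
    exact_mod_cast h1
  refine ⟨fun j => (polygonAngle a.den j : AddCircle (2 * π)), fun β => ?_,
    Metric.closedBall 0 (π / (2 * a.den)), Metric.isClosed_closedBall.measurableSet,
    haarAddCircle_frontier_closedBall _ _, fun hlim => ?_⟩
  · rw [hcast]
    exact tendsto_freq_arc_polygonAngle hle hq β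
  · have hq1 : (1 : ℝ) ≤ a.den := by exact_mod_cast hq
    rw [haarAddCircle_closedBall _ (by positivity) (div_le_self hπ.le (by linarith))] at hlim
    have hsub := hlim.comp (tendsto_id.const_mul_atTop' hq : Tendsto (fun M => a.den * M) atTop atTop)
    have hge := ge_of_tendsto hsub (b := 1 / (a.den : ℝ)) (by
      filter_upwards [eventually_gt_atTop 0] with M hM
      exact one_div_le_freq_mul hq (polygonAngle_mul_mem_closedBall hq) hM)
    have heq : π / (2 * (a.den : ℝ)) / π = 1 / a.den / 2 := by field_simp
    rw [heq] at hge
    have : 0 < 1 / (a.den : ℝ) := by positivity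
    linarith
end
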